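/- Let V be a finite-dimensional real inner product space and let R : ℝ → End(V) be a smooth family of self-adjoint endomorphisms satisfying the radial intermediate Ricci bound Ric_k ≥ 0. Let Λ be a Lagrangian subspace of abstract Jacobi fields for R and let t₀ ∈ ℝ. Let W ⊆ V be a k-dimensional subspace contained in {J(t₀) : J ∈ Λ} such that for some orthonormal basis (e₁, …, e_k) of W and some J₁, …, J_k ∈ Λ with Jᵢ(t₀) = eᵢ one has Σᵢ ⟨Jᵢ'(t₀), eᵢ⟩ ≤ 0. Let 𝒱 := {J ∈ Λ : J(t₀) ⊥ W} and assume 𝒱 has full index on [t₀, ∞). Then there is a subspace ℋ ⊆ Λ with Λ = 𝒱 ⊕ ℋ such that ⟨J(t), K(t)⟩ = 0 for all t ∈ [t₀, ∞), J ∈ 𝒱, K ∈ ℋ, and such that every nonzero K ∈ ℋ satisfies K(t) = f(t)·E on [t₀, ∞), where E is a unit vector of V lying in W and f : [t₀, ∞) → ℝ solves f'' = 0 with f(t₀) = |K(t₀)|. -/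

import Mathlib

open RealInnerProductSpace

variable {V : Type*} [NormedAddCommGroup V] [InnerProductSpace ℝ V]

/-- `J : ℝ → V` is an abstract Jacobi field for the curvature family `R`. -/
def IsJacobiField (R : ℝ → V →L[ℝ] V) (J : ℝ → V) : Prop :=
  ContDiff ℝ (⊤ : ℕ∞) J ∧ ∀ t : ℝ, deriv (deriv J) t = -(R t (J t))

/-- A Lagrangian subspace of abstract Jacobi fields: a subspace of the space of
Jacobi fields for `R` of dimension `dim V` on which the Wronskian vanishes. -/
def IsLagrangian [FiniteDimensional ℝ V] (R : ℝ → V →L[ℝ] V)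
    (Λ : Submodule ℝ (ℝ → V)) : Prop :=
  (∀ J ∈ Λ, IsJacobiField R J) ∧
    Module.finrank ℝ Λ = Module.finrank ℝ V ∧
    ∀ J₁ ∈ Λ, ∀ J₂ ∈ Λ, ∀ t : ℝ, ⟪deriv J₁ t, J₂ t⟫ = ⟪J₁ t, deriv J₂ t⟫

/-- `𝒲(t) = {J(t) : J ∈ 𝒲} + {J'(t) : J ∈ 𝒲, J(t) = 0}`. -/
def evalSp (𝒲 : Submodule ℝ (ℝ → V)) (t : ℝ) : Submodule ℝ V :=
  Submodule.span ℝ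
    ({x : V | ∃ J ∈ 𝒲, J t = x} ∪ {x : V | ∃ J ∈ 𝒲, J t = 0 ∧ deriv J t = x})

section RealAnalysis

open Filter Topology Set

/-- Monotonicity on a half-line only needs a nonnegative derivative immediately to the right of
each point. -/
lemma monotoneOn_Ici_of_eventually_hasDerivAt {f : ℝ → ℝ} {a : ℝ}
    (hc : ∀ t, a ≤ t → ContinuousAt f t)
    (hd : ∀ t, a ≤ t → ∀ᶠ u in 𝓝[>] t, ∃ d, 0 ≤ d ∧ HasDerivAt f d u) :
    MonotoneOn f (Ici a) := by
  intro x hx y hy hxy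
  have hx : a ≤ x := hx
  suffices h : Icc x y ⊆ {z | f x ≤ f z} from h ⟨hxy, le_rfl⟩
  refine IsClosed.Icc_subset_of_forall_mem_nhdsWithin ?_ (le_refl (f x)) ?_
  · have hcon : ContinuousOn f (Icc x y) := fun z hz =>
      (hc z (hx.trans hz.1)).continuousWithinAt
    have := hcon.preimage_isClosed_of_isClosed isClosed_Icc (isClosed_Ici (a := f x))
    rwa [inter_comm] at this
  · rintro z ⟨hz, hzx, -⟩
    obtain ⟨b, hb, hsub⟩ := mem_nhdsGT_iff_exists_Ioo_subset.1 (hd z (hx.trans hzx))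
    refine mem_nhdsGT_iff_exists_Ioo_subset.2 ⟨b, hb, fun u hu => ?_⟩
    have hmono : MonotoneOn f (Icc z u) := by
      refine monotoneOn_of_deriv_nonneg (convex_Icc z u)
        (fun v hv => (hc v (hx.trans (hzx.trans hv.1))).continuousWithinAt) ?_ ?_
      all_goals
        intro v hv
        rw [interior_Icc] at hv
        obtain ⟨d, hd0, hder⟩ := hsub ⟨hv.1, hv.2.trans hu.2⟩
      · exact hder.differentiableAt.differentiableWithinAt
      · rwa [hder.deriv]
    exact le_trans hz (hmono ⟨le_rfl, hu.1.le⟩ ⟨hu.1.le, le_rfl⟩ hu.1.le)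

/-- A solution on `[a, ∞)` of the Riccati inequality `f' ≤ -c f²` with `f a ≤ 0` vanishes. -/
lemma eq_zero_of_riccati_inequality {f : ℝ → ℝ} {a c : ℝ} (hc : 0 < c)
    (hcont : ∀ t, a ≤ t → ContinuousAt f t)
    (hd : ∀ t, a ≤ t → ∀ᶠ u in 𝓝[>] t, ∃ d, d ≤ -(c * f u ^ 2) ∧ HasDerivAt f d u)
    (ha : f a ≤ 0) {t : ℝ} (ht : a ≤ t) : f t = 0 := by
  have hmono : MonotoneOn (fun u => -f u) (Ici a) := by
    refine monotoneOn_Ici_of_eventually_hasDerivAt (fun u hu => (hcont u hu).neg) fun u hu => ?_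
    filter_upwards [hd u hu] with v ⟨d, hdv, hder⟩
    exact ⟨-d, by nlinarith [sq_nonneg (f v)], hder.neg⟩
  have hle : ∀ u v, a ≤ u → u ≤ v → f v ≤ f u := fun u v hu huv => by
    simpa using hmono hu (hu.trans huv) huv
  refine le_antisymm ((hle a t le_rfl ht).trans ha) ?_
  by_contra! hneg
  have hne : ∀ u, t ≤ u → f u < 0 := fun u hu => (hle t u ht hu).trans_lt hneg
  have hinv : MonotoneOn (fun u => (f u)⁻¹ - c * u) (Ici t) := by
    refine monotoneOn_Ici_of_eventually_hasDerivAt (fun u hu =>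
      ((hcont u (ht.trans hu)).inv₀ (hne u hu).ne).sub (by fun_prop)) fun u hu => ?_
    filter_upwards [hd u (ht.trans hu), self_mem_nhdsWithin] with v ⟨d, hdv, hder⟩ hv
    have hv0 := hne v (hu.trans (le_of_lt hv))
    refine ⟨-d / f v ^ 2 - c * 1, ?_,
      (hder.inv hv0.ne).sub ((hasDerivAt_id v).const_mul c)⟩
    have hpos : 0 < f v ^ 2 := by have := hv0.ne; positivity
    have := (le_div_iff₀ hpos).2 (show c * f v ^ 2 ≤ -d by linarith)
    linarith
  set u := t + (-(f t)⁻¹) / c with hu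
  have hinvneg : (f t)⁻¹ < 0 := inv_lt_zero.2 hneg
  have htu : t ≤ u := by
    have : 0 ≤ (-(f t)⁻¹) / c := div_nonneg (by linarith) hc.le
    linarith
  have h1 := hinv (mem_Ici.2 le_rfl) (mem_Ici.2 htu) htu
  have h2 : c * u = c * t - (f t)⁻¹ := by
    rw [hu]; field_simp; ring
  have h3 : (f u)⁻¹ < 0 := inv_lt_zero.2 (hne u htu)
  simp only at h1
  linarith

/-- A continuous function on a half-line whose derivative vanishes immediately to the right of each
point is constant. -/
lemma eq_of_eventually_hasDerivAt_zero {f : ℝ → ℝ} {a : ℝ}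
    (hc : ∀ t, a ≤ t → ContinuousAt f t)
    (hd : ∀ t, a ≤ t → ∀ᶠ u in 𝓝[>] t, HasDerivAt f 0 u) {t : ℝ} (ht : a ≤ t) :
    f t = f a := by
  have h1 := monotoneOn_Ici_of_eventually_hasDerivAt hc
    (fun u hu => (hd u hu).mono fun v hv => ⟨0, le_rfl, hv⟩)
  have h2 := monotoneOn_Ici_of_eventually_hasDerivAt (f := fun u => -f u)
    (fun u hu => (hc u hu).neg)
    (fun u hu => (hd u hu).mono fun v hv => ⟨-0, by simp, hv.neg⟩)
  have h3 := h1 (mem_Ici.2 le_rfl) (mem_Ici.2 ht) ht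
  have h4 := h2 (mem_Ici.2 le_rfl) (mem_Ici.2 ht) ht
  simp only at h4
  linarith

/-- Uniqueness for `Y'' + R Y = 0` on a compact interval. -/
lemma eqOn_zero_of_linear_second_order {R : ℝ → V →L[ℝ] V} (hR : Continuous R)
    {Y Z : ℝ → V} {a b t : ℝ} (ht : t ∈ Ioo a b) (hY : ContinuousOn Y (Icc a b))
    (hZ : ContinuousOn Z (Icc a b)) (hYd : ∀ u ∈ Ioo a b, HasDerivAt Y (Z u) u)
    (hZd : ∀ u ∈ Ioo a b, HasDerivAt Z (-(R u (Y u))) u) (hYt : Y t = 0) (hZt : Z t = 0) :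
    EqOn Y 0 (Icc a b) := by
  obtain ⟨C, hC⟩ := isCompact_Icc.exists_bound_of_continuousOn (hR.continuousOn (s := Icc a b))
  have key : EqOn (fun u => (Y u, Z u)) (fun _ => (0, 0)) (Icc a b) := by
    refine ODE_solution_unique_of_mem_Icc (v := fun u p => (p.2, -(R u p.1)))
      (s := fun _ => univ) (K := max 1 C.toNNReal) ?_ ht (hY.prodMk hZ)
      (fun u hu => (hYd u hu).prodMk (hZd u hu)) (fun _ _ => mem_univ _)
      continuousOn_const ?_ (fun _ _ => mem_univ _) (by simp [hYt, hZt])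
    · intro u hu
      refine (LipschitzWith.prod_snd.prodMk ?_).lipschitzOnWith
      refine (LipschitzWith.of_dist_le_mul fun p q => ?_)
      rw [dist_neg_neg, dist_eq_norm, ← map_sub]
      refine ((R u).le_of_opNorm_le ((hC u ⟨hu.1.le, hu.2.le⟩).trans
        (Real.le_coe_toNNReal C)) _).trans ?_
      gcongr
      rw [← dist_eq_norm]
      exact le_max_left _ _
    · intro u _
      rw [map_zero, neg_zero]
      exact hasDerivAt_const u ((0 : V), (0 : V))
  intro u hu
  simpa using congrArg Prod.fst (key hu)

end RealAnalysis

section OperatorAlgebra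

open Filter Topology
open scoped InnerProductSpace

variable [FiniteDimensional ℝ V]

/-- The trace as a continuous linear functional on continuous endomorphisms. -/
noncomputable def traceCLM (V : Type*) [NormedAddCommGroup V] [InnerProductSpace ℝ V]
    [FiniteDimensional ℝ V] : (V →L[ℝ] V) →L[ℝ] ℝ :=
  LinearMap.toContinuousLinearMap
    ((LinearMap.trace ℝ V).comp (ContinuousLinearMap.coeLM ℝ))

lemma traceCLM_apply (X : V →L[ℝ] V) : traceCLM V X = LinearMap.trace ℝ V X := rfl

lemma traceCLM_mul_comm (X Y : V →L[ℝ] V) : traceCLM V (X * Y) = traceCLM V (Y * X) :=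
  LinearMap.trace_mul_comm ℝ (X : V →ₗ[ℝ] V) Y

lemma traceCLM_eq_sum (X : V →L[ℝ] V) :
    traceCLM V X = ∑ i, ⟪stdOrthonormalBasis ℝ V i, X (stdOrthonormalBasis ℝ V i)⟫_ℝ :=
  LinearMap.trace_eq_sum_inner (X : V →ₗ[ℝ] V) (stdOrthonormalBasis ℝ V)

/-- The trace of `X` composed with the orthogonal projection to a subspace is computed by an
orthonormal basis of that subspace. -/
lemma traceCLM_mul_starProjection {ι : Type*} [Fintype ι] (X : V →L[ℝ] V) (K : Submodule ℝ V)
    {e : ι → V} (he : Orthonormal ℝ e) (hK : Submodule.span ℝ (Set.range e) = K) :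
    traceCLM V (X * K.starProjection) = ∑ i, ⟪X (e i), e i⟫_ℝ := by
  have hP : X * K.starProjection = ∑ i, InnerProductSpace.rankOne ℝ (X (e i)) (e i) := by
    ext x
    have heK : ∀ i, e i ∈ K := fun i => hK ▸ Submodule.subset_span ⟨i, rfl⟩
    have : K.starProjection x = ∑ i, ⟪e i, x⟫_ℝ • e i := by
      refine Submodule.eq_starProjection_of_mem_of_inner_eq_zero
        (Submodule.sum_mem _ fun i _ => K.smul_mem _ (heK i)) fun w hw => ?_
      rw [← hK] at hw
      induction hw using Submodule.span_induction with
      | mem w hw =>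
        obtain ⟨j, rfl⟩ := hw
        classical
        simp [inner_sub_left, sum_inner, inner_smul_left, orthonormal_iff_ite.1 he,
          real_inner_comm]
      | zero => simp
      | add u v _ _ hu hv => rw [inner_add_right, hu, hv, add_zero]
      | smul c u _ hu => rw [inner_smul_right, hu, mul_zero]
    simp [this]
  rw [hP, map_sum]
  refine Finset.sum_congr rfl fun i _ => ?_
  rw [traceCLM_apply, InnerProductSpace.trace_rankOne, real_inner_comm]

variable [CompleteSpace V]

lemma traceCLM_star_mul_self (X : V →L[ℝ] V) :
    traceCLM V (star X * X) =
      ∑ i, ‖X (stdOrthonormalBasis ℝ V i)‖ ^ 2 := by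
  rw [traceCLM_eq_sum]
  refine Finset.sum_congr rfl fun i _ => ?_
  rw [ContinuousLinearMap.star_eq_adjoint, mul_apply_eq_comp,
    ContinuousLinearMap.adjoint_inner_right, real_inner_self_eq_norm_sq]

lemma traceCLM_star_mul_self_nonneg (X : V →L[ℝ] V) : 0 ≤ traceCLM V (star X * X) := by
  rw [traceCLM_star_mul_self]; positivity

lemma eq_zero_of_traceCLM_star_mul_self {X : V →L[ℝ] V} (h : traceCLM V (star X * X) = 0) :
    X = 0 := by
  rw [traceCLM_star_mul_self, Finset.sum_eq_zero_iff_of_nonneg (fun _ _ => by positivity)] at h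
  have : (X : V →ₗ[ℝ] V) = 0 := (stdOrthonormalBasis ℝ V).toBasis.ext fun i => by
    simpa using h i (Finset.mem_univ i)
  ext x
  exact congrArg (fun f : V →ₗ[ℝ] V => f x) this

lemma sq_traceCLM_le (X : V →L[ℝ] V) :
    traceCLM V X ^ 2 ≤ Module.finrank ℝ V * traceCLM V (star X * X) := by
  rw [traceCLM_star_mul_self, traceCLM_eq_sum]
  refine sq_sum_le_card_mul_sum_sq.trans ?_
  rw [Finset.card_univ, Fintype.card_fin]
  refine mul_le_mul_of_nonneg_left (Finset.sum_le_sum fun i _ => sq_le_sq.2 ?_) (by positivity)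
  rw [abs_norm]
  simpa using abs_real_inner_le_norm (stdOrthonormalBasis ℝ V i) (X (stdOrthonormalBasis ℝ V i))

lemma ContinuousLinearMap.isUnit_of_ker_eq_zero {X : V →L[ℝ] V} (h : ∀ x, X x = 0 → x = 0) :
    IsUnit X := by
  have hinj : Function.Injective X := (injective_iff_map_eq_zero X).2 h
  exact ContinuousLinearMap.isUnit_iff_bijective.2
    ⟨hinj, (LinearMap.injective_iff_surjective (f := (X : V →ₗ[ℝ] V))).1 hinj⟩

/-- An explicit formula for the orthogonal projection to the image of `U` under an invertible
operator shows that it depends differentiably on the operator. -/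
lemma differentiableAt_starProjection_map (U : Submodule ℝ V) {M : V →L[ℝ] V} (hM : IsUnit M) :
    DifferentiableAt ℝ (fun X : V →L[ℝ] V => (U.map (X : V →ₗ[ℝ] V)).starProjection) M := by
  set q := U.starProjection with hq
  have hqs : star q = q := isSelfAdjoint_starProjection U
  have hqq : q * q = q := U.isIdempotentElem_starProjection
  set G : (V →L[ℝ] V) → (V →L[ℝ] V) := fun X => q * star X * X * q + (1 - q) with hG
  have hinner : ∀ x y, ⟪q x, y⟫_ℝ = ⟪x, q y⟫_ℝ := fun x y => by
    rw [hq, U.inner_starProjection_left_eq_right]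
  have hGunit : ∀ X, IsUnit X → IsUnit (G X) := by
    intro X hX
    have hXinj := (ContinuousLinearMap.isUnit_iff_bijective.1 hX).1
    refine ContinuousLinearMap.isUnit_of_ker_eq_zero fun x hx => ?_
    have h1 : ⟪G X x, x⟫_ℝ = ‖X (q x)‖ ^ 2 + ‖x - q x‖ ^ 2 := by
      have h2 : ⟪q x, x - q x⟫_ℝ = 0 := by
        rw [hinner, map_sub, ← mul_apply_eq_comp, hqq, sub_self, inner_zero_right]
      simp only [hG, add_apply, mul_apply_eq_comp,
        sub_apply, one_apply_eq_self, inner_add_left, hinner,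
        ContinuousLinearMap.star_eq_adjoint, ContinuousLinearMap.adjoint_inner_left]
      rw [real_inner_self_eq_norm_sq, ← real_inner_self_eq_norm_sq (x - q x),
        inner_sub_right (x - q x), real_inner_comm, real_inner_comm (q x), h2,
        sub_zero, real_inner_comm]
    rw [hx, inner_zero_left] at h1
    have h3 : ‖X (q x)‖ = 0 := by nlinarith [sq_nonneg ‖X (q x)‖, sq_nonneg ‖x - q x‖]
    have h4 : ‖x - q x‖ = 0 := by nlinarith [sq_nonneg ‖X (q x)‖, sq_nonneg ‖x - q x‖]
    have h5 : q x = 0 := hXinj (by rw [map_zero]; exact norm_eq_zero.1 h3)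
    rw [norm_eq_zero, h5, sub_zero] at h4
    exact h4
  have hformula : ∀ X : V →L[ℝ] V, IsUnit X → (U.map (X : V →ₗ[ℝ] V)).starProjection =
      X * q * Ring.inverse (G X) * q * star X := by
    intro X hX
    have hcomm : q * G X = G X * q := by
      simp only [hG, mul_add, add_mul, mul_sub, sub_mul, mul_one, one_mul, hqq]
      simp only [mul_assoc, hqq]
      simp only [← mul_assoc, hqq]
    have hinvl : Ring.inverse (G X) * G X = 1 := Ring.inverse_mul_cancel _ (hGunit X hX)
    have hinvr : G X * Ring.inverse (G X) = 1 := Ring.mul_inverse_cancel _ (hGunit X hX)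
    ext y
    refine Submodule.eq_starProjection_of_mem_of_inner_eq_zero ?_ ?_
    · exact ⟨q (Ring.inverse (G X) (q (star X y))), U.starProjection_apply_mem _, rfl⟩
    · rintro _ ⟨u, hu, rfl⟩
      have hqu : q u = u := Submodule.starProjection_eq_self_iff.2 hu
      have hid : q * star X * X * q * Ring.inverse (G X) * q = q := by
        calc q * star X * X * q * Ring.inverse (G X) * q
            = (q * G X) * Ring.inverse (G X) * q := by
              simp only [hG, mul_add, mul_sub, mul_one, hqq, sub_self, add_zero]
              simp only [← mul_assoc, hqq]
          _ = q := by rw [mul_assoc q, hinvr, mul_one, hqq]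
      have h1 : q (star X (y - X (q (Ring.inverse (G X) (q (star X y)))))) = 0 := by
        rw [map_sub, map_sub, sub_eq_zero]
        exact (congrArg (fun f : V →L[ℝ] V => f (star X y)) hid).symm
      change ⟪y - X (q (Ring.inverse (G X) (q (star X y)))), X u⟫_ℝ = 0
      rw [← ContinuousLinearMap.adjoint_inner_left, ← ContinuousLinearMap.star_eq_adjoint, ← hqu,
        ← hinner, h1, inner_zero_left]
  have hev : (fun X : V →L[ℝ] V => (U.map (X : V →ₗ[ℝ] V)).starProjection) =ᶠ[𝓝 M]
      fun X => X * q * Ring.inverse (G X) * q * star X := by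
    filter_upwards [Units.isOpen.mem_nhds hM] with X hX using hformula X hX
  refine DifferentiableAt.congr_of_eventuallyEq ?_ hev
  have hstar : DifferentiableAt ℝ (fun X : V →L[ℝ] V => star X) M := differentiableAt_id.star
  have hGd : DifferentiableAt ℝ G M := by
    refine DifferentiableAt.add ?_ (differentiableAt_const _)
    exact (((differentiableAt_const _).mul hstar).mul differentiableAt_id).mul
      (differentiableAt_const _)
  have hinv : DifferentiableAt ℝ (fun X => Ring.inverse (G X)) M :=
    (differentiableAt_inverse (hGunit M hM)).comp M hGd
  exact (((differentiableAt_id.mul (differentiableAt_const _)).mul hinv).mul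
    (differentiableAt_const _)).mul hstar

end OperatorAlgebra

section LagrangianPair

open Filter Topology Set
open scoped InnerProductSpace

variable [FiniteDimensional ℝ V]

/-- The values `A` and derivatives `B` at one time of a parametrized Lagrangian family of Jacobi
fields. -/
structure IsLagrangianPair (A B : V →L[ℝ] V) : Prop where
  wronskian : ∀ x y, ⟪B x, A y⟫_ℝ = ⟪A x, B y⟫_ℝ
  eq_zero : ∀ x, A x = 0 → B x = 0 → x = 0

/-- Orthogonal projection to the kernel. -/
noncomputable def kerProj (A : V →L[ℝ] V) : V →L[ℝ] V :=
  (LinearMap.ker (A : V →ₗ[ℝ] V)).starProjection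

/-- The operator that evaluates the derivative on the fields that vanish, and the value on the
orthogonal complement of these. -/
noncomputable def regularized (A B : V →L[ℝ] V) : V →L[ℝ] V :=
  A + B * kerProj A

/-- The orthogonal projection to the horizontal space, the orthogonal complement of the evaluation
of the subfamily `U`. -/
noncomputable def horizontalProj (U : Submodule ℝ V) (A B : V →L[ℝ] V) : V →L[ℝ] V :=
  1 - (U.map (regularized A B : V →ₗ[ℝ] V)).starProjection

/-- The operator sending `A x` to `B x` for `x` orthogonal to the kernel of `A`. -/
noncomputable def shapeOp (A B : V →L[ℝ] V) : V →L[ℝ] V :=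
  B * (1 - kerProj A) * Ring.inverse (regularized A B)

/-- The Riccati operator induced on the horizontal space. -/
noncomputable def riccatiOp (U : Submodule ℝ V) (A B : V →L[ℝ] V) : V →L[ℝ] V :=
  horizontalProj U A B * shapeOp A B * horizontalProj U A B

lemma apply_kerProj (A : V →L[ℝ] V) (x : V) : A (kerProj A x) = 0 :=
  LinearMap.mem_ker.1
    (Submodule.starProjection_apply_mem (LinearMap.ker (A : V →ₗ[ℝ] V)) x)

lemma mul_kerProj (A : V →L[ℝ] V) : A * kerProj A = 0 := by
  ext x; exact apply_kerProj A x

lemma kerProj_apply_eq_self {A : V →L[ℝ] V} {x : V} (hx : A x = 0) : kerProj A x = x :=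
  Submodule.starProjection_eq_self_iff.2 (LinearMap.mem_ker.2 hx)

lemma kerProj_mul_self (A : V →L[ℝ] V) : kerProj A * kerProj A = kerProj A :=
  Submodule.isIdempotentElem_starProjection _

lemma kerProj_eq_zero {A : V →L[ℝ] V} (hA : IsUnit A) : kerProj A = 0 := by
  ext x
  have hinj := (ContinuousLinearMap.isUnit_iff_bijective.1 hA).1
  exact hinj (by rw [apply_kerProj, zero_apply, map_zero])

lemma regularized_eq {A : V →L[ℝ] V} (hA : IsUnit A) (B : V →L[ℝ] V) : regularized A B = A := by
  simp [regularized, kerProj_eq_zero hA]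

lemma shapeOp_eq {A : V →L[ℝ] V} (hA : IsUnit A) (B : V →L[ℝ] V) :
    shapeOp A B = B * Ring.inverse A := by
  simp [shapeOp, kerProj_eq_zero hA, regularized_eq hA]

lemma horizontalProj_mul_self (U : Submodule ℝ V) (A B : V →L[ℝ] V) :
    horizontalProj U A B * horizontalProj U A B = horizontalProj U A B := by
  rw [horizontalProj, ← Submodule.starProjection_orthogonal']
  exact Submodule.isIdempotentElem_starProjection _

lemma horizontalProj_apply_regularized {U : Submodule ℝ V} (A B : V →L[ℝ] V) {u : V}
    (hu : u ∈ U) : horizontalProj U A B (regularized A B u) = 0 := by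
  rw [horizontalProj, sub_apply, one_apply_eq_self, sub_eq_zero, eq_comm,
    Submodule.starProjection_eq_self_iff]
  exact ⟨u, hu, rfl⟩

lemma inner_regularized_horizontalProj {U : Submodule ℝ V} (A B : V →L[ℝ] V) {u : V}
    (hu : u ∈ U) (x : V) : ⟪regularized A B u, horizontalProj U A B x⟫_ℝ = 0 := by
  rw [horizontalProj, ← Submodule.starProjection_orthogonal']
  exact Submodule.inner_right_of_mem_orthogonal (Submodule.mem_map_of_mem hu)
    (Submodule.starProjection_apply_mem _ x)

lemma regularized_sub_kerProj (A B : V →L[ℝ] V) (x : V) :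
    regularized A B (x - kerProj A x) = A x := by
  have : kerProj A (kerProj A x) = kerProj A x := kerProj_apply_eq_self (apply_kerProj A x)
  simp [regularized, apply_kerProj, this]

lemma regularized_kerProj (A B : V →L[ℝ] V) (x : V) :
    regularized A B (kerProj A x) = B (kerProj A x) := by
  have : kerProj A (kerProj A x) = kerProj A x := kerProj_apply_eq_self (apply_kerProj A x)
  simp [regularized, apply_kerProj, this]

lemma inner_apply_horizontalProj {U : Submodule ℝ V} {A : V →L[ℝ] V}
    (hU : ∀ x, A x = 0 → x ∈ U) (B : V →L[ℝ] V) {u : V} (hu : u ∈ U) (x : V) :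
    ⟪A u, horizontalProj U A B x⟫_ℝ = 0 := by
  rw [← regularized_sub_kerProj A B u]
  exact inner_regularized_horizontalProj A B (U.sub_mem hu (hU _ (apply_kerProj A u))) x

lemma horizontalProj_eq_self {U : Submodule ℝ V} {A B : V →L[ℝ] V} {w : V}
    (h1 : ∀ u ∈ U, ⟪A u, w⟫_ℝ = 0) (h2 : ∀ u, A u = 0 → ⟪B u, w⟫_ℝ = 0) :
    horizontalProj U A B w = w := by
  rw [horizontalProj, ← Submodule.starProjection_orthogonal',
    Submodule.starProjection_eq_self_iff, Submodule.mem_orthogonal]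
  rintro _ ⟨u, hu, rfl⟩
  change ⟪A u + B (kerProj A u), w⟫_ℝ = 0
  rw [inner_add_left, h1 u hu, h2 _ (apply_kerProj A u), add_zero]

lemma star_horizontalProj [CompleteSpace V] (U : Submodule ℝ V) (A B : V →L[ℝ] V) :
    star (horizontalProj U A B) = horizontalProj U A B := by
  rw [horizontalProj, ← Submodule.starProjection_orthogonal']
  exact isSelfAdjoint_starProjection _

namespace IsLagrangianPair

variable {A B : V →L[ℝ] V} (h : IsLagrangianPair A B)

include h

lemma inner_eq_zero (x y : V) : ⟪A x, B (kerProj A y)⟫_ℝ = 0 := by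
  rw [← h.wronskian, apply_kerProj, inner_zero_right]

variable [CompleteSpace V]

lemma isUnit_regularized : IsUnit (regularized A B) := by
  refine ContinuousLinearMap.isUnit_of_ker_eq_zero fun x hx => ?_
  change A x + B (kerProj A x) = 0 at hx
  have h1 : A x = 0 := by
    have := h.inner_eq_zero x x
    rw [eq_neg_of_add_eq_zero_right hx, inner_neg_right, neg_eq_zero] at this
    exact inner_self_eq_zero.1 this
  rw [h1, zero_add, kerProj_apply_eq_self h1] at hx
  exact h.eq_zero x h1 hx

/-- The range of `A` contains the orthogonal complement of `B (ker A)`. -/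
lemma exists_apply_eq {x : V} (hx : ∀ y, ⟪x, B (kerProj A y)⟫_ℝ = 0) : ∃ v, A v = x := by
  obtain ⟨v, rfl⟩ := (ContinuousLinearMap.isUnit_iff_bijective.1 h.isUnit_regularized).2 x
  have h1 : B (kerProj A v) = 0 := by
    have h2 := hx v
    change ⟪A v + B (kerProj A v), _⟫_ℝ = 0 at h2
    rw [inner_add_left, h.inner_eq_zero, zero_add] at h2
    exact inner_self_eq_zero.1 h2
  exact ⟨v, by simp [regularized, h1]⟩

/-- Every horizontal vector is a value `A v`. -/
lemma exists_apply_eq_horizontalProj {U : Submodule ℝ V} (hU : ∀ x, A x = 0 → x ∈ U) (x : V) :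
    ∃ v, A v = horizontalProj U A B x := by
  refine h.exists_apply_eq fun y => ?_
  rw [← regularized_kerProj, real_inner_comm]
  exact inner_regularized_horizontalProj A B (hU _ (apply_kerProj A y)) x

lemma inverse_regularized_apply (v : V) :
    Ring.inverse (regularized A B) (A v) = v - kerProj A v := by
  rw [← regularized_sub_kerProj A B v, ← mul_apply_eq_comp,
    Ring.inverse_mul_cancel _ h.isUnit_regularized, one_apply_eq_self]

lemma kerProj_mul_inverse_mul_horizontalProj {U : Submodule ℝ V} (hU : ∀ x, A x = 0 → x ∈ U) :
    kerProj A * Ring.inverse (regularized A B) * horizontalProj U A B = 0 := by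
  ext x
  obtain ⟨v, hv⟩ := h.exists_apply_eq_horizontalProj hU x
  rw [mul_apply_eq_comp, mul_apply_eq_comp, ← hv, h.inverse_regularized_apply, map_sub,
    kerProj_apply_eq_self (apply_kerProj A v), sub_self, zero_apply]

lemma shapeOp_apply (v : V) : shapeOp A B (A v) = B (v - kerProj A v) := by
  rw [shapeOp, mul_apply_eq_comp, h.inverse_regularized_apply]
  simp [kerProj_apply_eq_self (apply_kerProj A v)]

lemma riccatiOp_apply {U : Submodule ℝ V} (hU : ∀ x, A x = 0 → x ∈ U) {v x : V}
    (hv : A v = horizontalProj U A B x) :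
    riccatiOp U A B x = horizontalProj U A B (B v) := by
  rw [riccatiOp, mul_apply_eq_comp, mul_apply_eq_comp, ← hv, h.shapeOp_apply, map_sub, map_sub,
    ← regularized_kerProj, horizontalProj_apply_regularized A B (hU _ (apply_kerProj A v)),
    sub_zero]

lemma star_shapeOp (hA : IsUnit A) : star (shapeOp A B) = shapeOp A B := by
  rw [ContinuousLinearMap.star_eq_adjoint, eq_comm, ContinuousLinearMap.eq_adjoint_iff]
  intro x y
  have hsurj := (ContinuousLinearMap.isUnit_iff_bijective.1 hA).2
  obtain ⟨x, rfl⟩ := hsurj x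
  obtain ⟨y, rfl⟩ := hsurj y
  rw [h.shapeOp_apply, h.shapeOp_apply]
  simpa [kerProj_eq_zero hA] using h.wronskian x y

end IsLagrangianPair

end LagrangianPair

section LagrangianFrame

open Filter Topology Set Asymptotics
open scoped InnerProductSpace

/-- If `A' = B` and `B` is differentiable at `t`, then `(B u - slope A t u) / (u - t)` is bounded
near `t`. -/
lemma isBigO_sub_dslope {F : Type*} [NormedAddCommGroup F] [NormedSpace ℝ F] {A B : ℝ → F}
    (hA : ∀ u, HasDerivAt A (B u) u) {t : ℝ} (hB : DifferentiableAt ℝ B t) :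
    (fun u => (u - t)⁻¹ • (B u - dslope A t u)) =O[𝓝[≠] t] (fun _ => (1 : ℝ)) := by
  obtain ⟨C, hC⟩ := hB.hasDerivAt.isBigO_sub.bound
  obtain ⟨ε, hε, hball⟩ := Metric.eventually_nhds_iff_ball.1 hC
  refine IsBigO.of_bound (2 * C) ?_
  filter_upwards [self_mem_nhdsWithin, nhdsWithin_le_nhds (Metric.ball_mem_nhds t hε)] with u hu hub
  have hut : 0 < ‖u - t‖ := norm_pos_iff.2 (sub_ne_zero.2 hu)
  have hCu := hball u hub
  have hC0 : 0 ≤ C := by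
    have := (norm_nonneg _).trans hCu
    exact nonneg_of_mul_nonneg_left this hut
  have hmv : ‖(A u - u • B t) - (A t - t • B t)‖ ≤ C * ‖u - t‖ * ‖u - t‖ := by
    refine Convex.norm_image_sub_le_of_norm_hasDerivWithin_le
      (f := fun v => A v - v • B t) (f' := fun v => B v - B t) (s := Metric.closedBall t ‖u - t‖)
      (fun v _ => ?_) (fun v hv => ?_) (convex_closedBall _ _)
      (Metric.mem_closedBall_self hut.le) (by simp [dist_eq_norm])
    · have := ((hasDerivAt_id v).smul_const (B t))
      rw [one_smul] at this
      exact ((hA v).sub this).hasDerivWithinAt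
    · rw [Metric.mem_closedBall, dist_eq_norm] at hv
      rw [Metric.mem_ball, dist_eq_norm] at hub
      refine (hball v ?_).trans (by gcongr)
      rw [Metric.mem_ball, dist_eq_norm]
      exact hv.trans_lt hub
  have hid : (u - t) • (B u - dslope A t u) =
      (u - t) • (B u - B t) - ((A u - u • B t) - (A t - t • B t)) := by
    rw [smul_sub, sub_smul_dslope]
    module
  have hmain : ‖u - t‖ * ‖B u - dslope A t u‖ ≤ ‖u - t‖ * (2 * C * ‖u - t‖) := by
    rw [← norm_smul, hid]
    refine (norm_sub_le _ _).trans ?_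
    rw [norm_smul]
    nlinarith [mul_le_mul_of_nonneg_left hCu hut.le]
  have hmain' := le_of_mul_le_mul_left hmain hut
  rw [norm_smul, norm_inv, norm_one, mul_one, inv_mul_le_iff₀ hut]
  linarith

variable [FiniteDimensional ℝ V]

/-- A parametrized Lagrangian family of Jacobi fields: `A t v` is the value at time `t` of the
field with parameter `v`, and `B t v` the value of its derivative. -/
structure IsLagrangianFrame (R A B : ℝ → V →L[ℝ] V) : Prop where
  hasDerivAt_left : ∀ t, HasDerivAt A (B t) t
  hasDerivAt_right : ∀ t, HasDerivAt B (-(R t * A t)) t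
  isLagrangianPair : ∀ t, IsLagrangianPair (A t) (B t)

variable {R A B : ℝ → V →L[ℝ] V} (h : IsLagrangianFrame R A B)

namespace IsLagrangianFrame

/-- Near `t`, the operator `A u` with its zeros at `u = t` divided out. -/
noncomputable def dividedOp (A : ℝ → V →L[ℝ] V) (t u : ℝ) : V →L[ℝ] V :=
  A u * (1 - kerProj (A t)) + dslope A t u * kerProj (A t)

lemma dividedOp_mul (A : ℝ → V →L[ℝ] V) (t u : ℝ) :
    dividedOp A t u * ((1 - kerProj (A t)) + (u - t) • kerProj (A t)) = A u := by
  have h1 : (u - t) • dslope A t u = A u - A t := sub_smul_dslope A t u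
  have hk := kerProj_mul_self (A t)
  have h2 : (u - t) • (dslope A t u * kerProj (A t)) = A u * kerProj (A t) := by
    rw [← smul_mul_assoc, h1, sub_mul, mul_kerProj, sub_zero]
  have h3 : dividedOp A t u * (1 - kerProj (A t)) = A u * (1 - kerProj (A t)) := by
    simp only [dividedOp, add_mul, mul_sub, mul_one, sub_mul, mul_assoc, hk]
    abel
  have h4 : dividedOp A t u * kerProj (A t) = dslope A t u * kerProj (A t) := by
    simp only [dividedOp, add_mul, mul_sub, mul_one, sub_mul, mul_assoc, hk]
    abel
  rw [mul_add, mul_smul_comm, h3, h4, h2, mul_sub, mul_one, sub_add_cancel]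

lemma mul_eq_dividedOp (A : ℝ → V →L[ℝ] V) {t u : ℝ} (hu : u ≠ t) :
    A u * ((1 - kerProj (A t)) + (u - t)⁻¹ • kerProj (A t)) = dividedOp A t u := by
  have hu' : u - t ≠ 0 := sub_ne_zero.2 hu
  have h1 : dslope A t u = (u - t)⁻¹ • (A u - A t) := by
    rw [dslope_of_ne A hu, slope_def_module]
  rw [dividedOp, h1, mul_add, mul_smul_comm, smul_mul_assoc, sub_mul _ _ (kerProj (A t)),
    mul_kerProj, sub_zero]

include h

lemma dividedOp_self (t : ℝ) : dividedOp A t t = regularized (A t) (B t) := by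
  rw [dividedOp, dslope_same, (h.hasDerivAt_left t).deriv, mul_sub, mul_one, mul_kerProj, sub_zero,
    regularized]

lemma continuousAt_dividedOp (t : ℝ) : ContinuousAt (dividedOp A t) t :=
  ((h.hasDerivAt_left t).continuousAt.mul continuousAt_const).add
    ((continuousAt_dslope_same.2 (h.hasDerivAt_left t).differentiableAt).mul continuousAt_const)

variable [CompleteSpace V]

lemma isUnit_dividedOp_self (t : ℝ) : IsUnit (dividedOp A t t) := by
  rw [h.dividedOp_self]
  exact (h.isLagrangianPair t).isUnit_regularized

lemma eventually_isUnit_dividedOp (t : ℝ) : ∀ᶠ u in 𝓝 t, IsUnit (dividedOp A t u) :=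
  (h.continuousAt_dividedOp t).eventually (Units.isOpen.mem_nhds (h.isUnit_dividedOp_self t))

/-- The times at which some nonzero field of the family vanishes are isolated. -/
lemma eventually_isUnit (t : ℝ) : ∀ᶠ u in 𝓝[≠] t, IsUnit (A u) := by
  filter_upwards [self_mem_nhdsWithin, nhdsWithin_le_nhds (h.eventually_isUnit_dividedOp t)]
    with u hu hunit
  refine ContinuousLinearMap.isUnit_of_ker_eq_zero fun x hx => ?_
  have hinj := (ContinuousLinearMap.isUnit_iff_bijective.1 hunit).1
  have hu' : u - t ≠ 0 := sub_ne_zero.2 hu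
  rw [← dividedOp_mul A t u, mul_apply_eq_comp, ← map_zero (dividedOp A t u)] at hx
  have h1 := hinj hx
  simp only [add_apply, sub_apply, one_apply_eq_self, smul_apply] at h1
  have h2 : kerProj (A t) x = 0 := by
    have := congrArg (kerProj (A t)) h1
    rw [map_add, map_sub, map_smul, kerProj_apply_eq_self (apply_kerProj (A t) x), sub_self,
      zero_add, map_zero, smul_eq_zero] at this
    exact this.resolve_left hu'
  simpa [h2] using h1

variable {U : Submodule ℝ V}

lemma horizontalProj_eventuallyEq {t : ℝ} (hU : ∀ x, A t x = 0 → x ∈ U) :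
    (fun u => horizontalProj U (A u) (B u)) =ᶠ[𝓝 t]
      fun u => 1 - (U.map (dividedOp A t u : V →ₗ[ℝ] V)).starProjection := by
  have hπ : ∀ x, kerProj (A t) x ∈ U := fun x => hU _ (apply_kerProj (A t) x)
  filter_upwards [eventually_nhdsWithin_iff.1 (h.eventually_isUnit t)] with u hu
  rcases eq_or_ne u t with rfl | hne
  · rw [h.dividedOp_self, horizontalProj]
  · simp only [horizontalProj, regularized_eq (hu hne)]
    congr 2
    refine le_antisymm ?_ ?_ <;> rintro _ ⟨x, hx, rfl⟩
    · refine ⟨x - kerProj (A t) x + (u - t) • kerProj (A t) x,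
        U.add_mem (U.sub_mem hx (hπ x)) (U.smul_mem _ (hπ x)), ?_⟩
      exact congrArg (fun f : V →L[ℝ] V => f x) (dividedOp_mul A t u)
    · refine ⟨x - kerProj (A t) x + (u - t)⁻¹ • kerProj (A t) x,
        U.add_mem (U.sub_mem hx (hπ x)) (U.smul_mem _ (hπ x)), ?_⟩
      exact congrArg (fun f : V →L[ℝ] V => f x) (mul_eq_dividedOp A hne)

lemma continuousAt_horizontalProj {t : ℝ} (hU : ∀ x, A t x = 0 → x ∈ U) :
    ContinuousAt (fun u => horizontalProj U (A u) (B u)) t := by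
  refine ContinuousAt.congr ?_ (h.horizontalProj_eventuallyEq hU).symm
  exact continuousAt_const.sub (ContinuousAt.comp (x := t)
    (g := fun X : V →L[ℝ] V => (U.map (X : V →ₗ[ℝ] V)).starProjection)
    (differentiableAt_starProjection_map U (h.isUnit_dividedOp_self t)).continuousAt
    (h.continuousAt_dividedOp t))

/-- The Riccati operator extends continuously across the zeros of fields in `U`. -/
lemma continuousAt_riccatiOp {t : ℝ} (hU : ∀ x, A t x = 0 → x ∈ U) :
    ContinuousAt (fun u => riccatiOp U (A u) (B u)) t := by
  set π := kerProj (A t) with hπ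
  set P : ℝ → V →L[ℝ] V := fun u => horizontalProj U (A u) (B u) with hP
  set L : ℝ → V →L[ℝ] V := fun u => Ring.inverse (dividedOp A t u) with hL
  have hPc : ContinuousAt P t := h.continuousAt_horizontalProj hU
  have hLc : ContinuousAt L t := by
    obtain ⟨x, hx⟩ := h.isUnit_dividedOp_self t
    have hinv := NormedRing.inverse_continuousAt x
    rw [hx] at hinv
    exact ContinuousAt.comp (x := t) hinv (h.continuousAt_dividedOp t)
  have hBc : ContinuousAt B t := (h.hasDerivAt_right t).continuousAt
  have hvanish : π * L t * P t = 0 := by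
    simp only [hL, h.dividedOp_self]
    exact (h.isLagrangianPair t).kerProj_mul_inverse_mul_horizontalProj hU
  have hmain : ContinuousAt (fun u => P u * (B u * (1 - π) * L u) * P u) t :=
    (hPc.mul ((hBc.mul continuousAt_const).mul hLc)).mul hPc
  have herr : Tendsto (fun u => P u * ((u - t)⁻¹ • (B u - dslope A t u)) * (π * L u * P u))
      (𝓝[≠] t) (𝓝 0) := by
    have h1 : (fun u => π * L u * P u) =o[𝓝[≠] t] (fun _ => (1 : ℝ)) := by
      rw [isLittleO_one_iff, ← hvanish]
      exact ((continuousAt_const.mul hLc).mul hPc).tendsto.mono_left nhdsWithin_le_nhds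
    have h2 : P =O[𝓝[≠] t] (fun _ => (1 : ℝ)) :=
      (hPc.tendsto.mono_left nhdsWithin_le_nhds).isBigO_one ℝ
    have h3 := isBigO_sub_dslope h.hasDerivAt_left (h.hasDerivAt_right t).differentiableAt
    have h4 := (h2.mul h3).mul_isLittleO h1
    simpa only [mul_one, isLittleO_one_iff] using h4
  rw [continuousAt_iff_punctured_nhds]
  have hlim := (hmain.tendsto.mono_left (nhdsWithin_le_nhds (s := {t}ᶜ))).add herr
  have hval : P t * (B t * (1 - π) * L t) * P t + 0 = riccatiOp U (A t) (B t) := by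
    simp only [hL, h.dividedOp_self, add_zero]
    rfl
  rw [hval] at hlim
  refine hlim.congr' ?_
  filter_upwards [self_mem_nhdsWithin, h.eventually_isUnit t,
    nhdsWithin_le_nhds (h.eventually_isUnit_dividedOp t),
    nhdsWithin_le_nhds (h.horizontalProj_eventuallyEq hU)] with u hu hAu hDu hPu
  have hππ : π * π = π := kerProj_mul_self (A t)
  have hinv : Ring.inverse (A u) = ((1 - π) + (u - t)⁻¹ • π) * L u := by
    have hone : A u * (((1 - π) + (u - t)⁻¹ • π) * L u) = 1 := by
      rw [← mul_assoc, hπ, mul_eq_dividedOp A hu, hL, Ring.mul_inverse_cancel _ hDu]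
    calc Ring.inverse (A u) = Ring.inverse (A u) * (A u * (((1 - π) + (u - t)⁻¹ • π) * L u)) := by
          rw [hone, mul_one]
      _ = _ := by rw [← mul_assoc, Ring.inverse_mul_cancel _ hAu, one_mul]
  have hPd : P u * dslope A t u * π = 0 := by
    ext x
    have hx : π x ∈ U := hU _ (apply_kerProj (A t) x)
    have h1 : dslope A t u (π x) = dividedOp A t u (π x) := by
      have : π (π x) = π x := congrArg (fun f : V →L[ℝ] V => f x) hππ
      simp [dividedOp, ← hπ, this]
    have hPu' : P u = 1 - (U.map (dividedOp A t u : V →ₗ[ℝ] V)).starProjection := hPu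
    rw [mul_apply_eq_comp, mul_apply_eq_comp, h1, hPu', sub_apply, one_apply_eq_self, zero_apply,
      sub_eq_zero, eq_comm, Submodule.starProjection_eq_self_iff]
    exact ⟨π x, hx, rfl⟩
  have hsecond : P u * ((u - t)⁻¹ • (B u - dslope A t u)) * (π * L u * P u) =
      (u - t)⁻¹ • (P u * B u * π * L u * P u) := by
    rw [mul_smul_comm, smul_mul_assoc]
    congr 1
    calc P u * (B u - dslope A t u) * (π * L u * P u)
        = P u * B u * π * L u * P u - P u * dslope A t u * π * (L u * P u) := by
          noncomm_ring
      _ = _ := by rw [hPd, zero_mul, sub_zero]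
  rw [hsecond, riccatiOp, shapeOp_eq hAu, hinv]
  change _ = P u * (B u * ((1 - π + (u - t)⁻¹ • π) * L u)) * P u
  simp only [add_mul, mul_add, smul_mul_assoc, mul_smul_comm, mul_assoc]

omit [FiniteDimensional ℝ V] in
lemma eventually_isUnit_nhds {t : ℝ} (hAt : IsUnit (A t)) : ∀ᶠ u in 𝓝 t, IsUnit (A u) :=
  (h.hasDerivAt_left t).continuousAt.eventually (Units.isOpen.mem_nhds hAt)

/-- The shape operator satisfies the Riccati equation. -/
lemma hasDerivAt_shapeOp {t : ℝ} (hAt : IsUnit (A t)) :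
    HasDerivAt (fun u => shapeOp (A u) (B u))
      (-R t - shapeOp (A t) (B t) * shapeOp (A t) (B t)) t := by
  obtain ⟨x, hx⟩ := hAt
  have hinv : HasDerivAt (fun u => Ring.inverse (A u))
      (-(Ring.inverse (A t) * B t * Ring.inverse (A t))) t := by
    have h1 := hasFDerivAt_ringInverse (𝕜 := ℝ) x
    rw [hx] at h1
    have h2 := h1.comp_hasDerivAt t (h.hasDerivAt_left t)
    rw [← hx, Ring.inverse_unit]
    simpa [Function.comp_def] using h2
  have hprod := (h.hasDerivAt_right t).mul hinv
  have hAt : IsUnit (A t) := ⟨x, hx⟩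
  have hev : (fun u => shapeOp (A u) (B u)) =ᶠ[𝓝 t] B * fun u => Ring.inverse (A u) := by
    filter_upwards [h.eventually_isUnit_nhds hAt] with u hu using shapeOp_eq hu (B u)
  refine (hprod.congr_of_eventuallyEq hev).congr_deriv ?_
  rw [shapeOp_eq hAt, neg_mul, mul_assoc (R t), Ring.mul_inverse_cancel _ hAt, mul_one]
  noncomm_ring

omit [FiniteDimensional ℝ V] h in
/-- The algebraic relations that determine the derivative of a projection. -/
lemma eq_of_projection_relations {P S D : V →L[ℝ] V} (hPP : P * P = P) (hP : star P = P)
    (hS : star S = S) (hD : star D = D) (hDP : D * P + P * D = D)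
    (hDQ : D * (1 - P) = -(P * S * (1 - P))) :
    D = -(P * S * (1 - P)) - (1 - P) * S * P := by
  have h1 : P * D * P = 0 := by
    have := congrArg (fun X => P * X) hDP
    simp only [mul_add, ← mul_assoc, hPP] at this
    simpa using this
  have h2 : (1 - P) * D = -((1 - P) * S * P) := by
    have := congrArg star hDQ
    simpa [star_mul, star_sub, hP, hS, hD, mul_assoc] using this
  have h3 : D * P = -((1 - P) * S * P) := by
    calc D * P = (1 - P) * D * P + P * D * P := by noncomm_ring
      _ = -((1 - P) * S * P) := by rw [h1, h2, add_zero, neg_mul, mul_assoc, hPP]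
  calc D = D * (1 - P) + D * P := by noncomm_ring
    _ = _ := by rw [hDQ, h3]; abel

lemma hasDerivAt_horizontalProj (U : Submodule ℝ V) {t : ℝ} (hAt : IsUnit (A t)) :
    HasDerivAt (fun u => horizontalProj U (A u) (B u))
      (-(horizontalProj U (A t) (B t) * shapeOp (A t) (B t) *
          (1 - horizontalProj U (A t) (B t))) -
        (1 - horizontalProj U (A t) (B t)) * shapeOp (A t) (B t) *
          horizontalProj U (A t) (B t)) t := by
  set P : ℝ → V →L[ℝ] V := fun u => horizontalProj U (A u) (B u) with hP
  have hunits := h.eventually_isUnit_nhds hAt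
  have hdiff : DifferentiableAt ℝ P t := by
    have hev : P =ᶠ[𝓝 t] fun u => 1 - (U.map (A u : V →ₗ[ℝ] V)).starProjection := by
      filter_upwards [hunits] with u hu
      simp only [hP, horizontalProj, regularized_eq hu]
    refine DifferentiableAt.congr_of_eventuallyEq ?_ hev
    exact (differentiableAt_const _).sub (DifferentiableAt.comp t
      (g := fun X : V →L[ℝ] V => (U.map (X : V →ₗ[ℝ] V)).starProjection)
      (differentiableAt_starProjection_map U hAt) (h.hasDerivAt_left t).differentiableAt)
  obtain ⟨D, hD⟩ : ∃ D, HasDerivAt P D t := ⟨_, hdiff.hasDerivAt⟩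
  refine hD.congr_deriv (eq_of_projection_relations (horizontalProj_mul_self U _ _)
    (star_horizontalProj U _ _) ((h.isLagrangianPair t).star_shapeOp hAt) ?_ ?_ ?_)
  · refine hD.star.unique (hD.congr_of_eventuallyEq (Eventually.of_forall fun u => ?_))
    exact star_horizontalProj U _ _
  · refine (hD.mul hD).unique (hD.congr_of_eventuallyEq (Eventually.of_forall fun u => ?_))
    exact horizontalProj_mul_self U _ _
  · have hzero : D * A t * U.starProjection + P t * B t * U.starProjection = 0 := by
      have h1 := (hD.mul (h.hasDerivAt_left t)).mul_const U.starProjection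
      have h2 : (fun u => (P * A) u * U.starProjection) =ᶠ[𝓝 t] fun _ => 0 := by
        filter_upwards [hunits] with u hu
        ext x
        have := horizontalProj_apply_regularized (A u) (B u)
          (U.starProjection_apply_mem x)
        rwa [regularized_eq hu] at this
      have h3 := h1.unique ((hasDerivAt_const t (0 : V →L[ℝ] V)).congr_of_eventuallyEq h2)
      rwa [add_mul] at h3
    ext x
    obtain ⟨u, hu, hux⟩ : ∃ u ∈ U, A t u = (1 - P t) x := by
      have := (U.map (A t : V →ₗ[ℝ] V)).starProjection_apply_mem x
      obtain ⟨u, hu, hux⟩ := this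
      refine ⟨u, hu, ?_⟩
      simp only [hP, horizontalProj, regularized_eq hAt, sub_sub_cancel]
      exact hux
    have h1 := congrArg (fun f : V →L[ℝ] V => f u) hzero
    simp only [add_apply, mul_apply_eq_comp, Submodule.starProjection_eq_self_iff.2 hu,
      zero_apply] at h1
    have h2 : shapeOp (A t) (B t) (A t u) = B t u := by
      rw [(h.isLagrangianPair t).shapeOp_apply]
      simp [kerProj_eq_zero hAt]
    change D ((1 - P t) x) = -(P t (shapeOp (A t) (B t) ((1 - P t) x)))
    rw [← hux, h2]
    exact eq_neg_of_add_eq_zero_left h1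

lemma hasDerivAt_trace_riccatiOp (U : Submodule ℝ V) {t : ℝ} (hAt : IsUnit (A t)) :
    HasDerivAt (fun u => traceCLM V (riccatiOp U (A u) (B u)))
      (-traceCLM V (R t * horizontalProj U (A t) (B t)) -
        traceCLM V (star (riccatiOp U (A t) (B t)) * riccatiOp U (A t) (B t)) -
        3 * traceCLM V
          (star ((1 - horizontalProj U (A t) (B t)) * shapeOp (A t) (B t) *
              horizontalProj U (A t) (B t)) *
            ((1 - horizontalProj U (A t) (B t)) * shapeOp (A t) (B t) *
              horizontalProj U (A t) (B t)))) t := by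
  have htr : (fun u => traceCLM V (riccatiOp U (A u) (B u))) = fun u =>
      traceCLM V (((fun v => horizontalProj U (A v) (B v)) *
        fun v => shapeOp (A v) (B v)) u) := by
    funext u
    rw [riccatiOp, traceCLM_mul_comm, ← mul_assoc, horizontalProj_mul_self, Pi.mul_apply]
  rw [htr]
  refine ((traceCLM V).hasFDerivAt.comp_hasDerivAt t
    ((h.hasDerivAt_horizontalProj U hAt).mul (h.hasDerivAt_shapeOp hAt))).congr_deriv ?_
  have hP := star_horizontalProj U (A t) (B t)
  have hPP := horizontalProj_mul_self U (A t) (B t)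
  have hS := (h.isLagrangianPair t).star_shapeOp hAt
  rw [riccatiOp]
  generalize horizontalProj U (A t) (B t) = P at hP hPP ⊢
  generalize shapeOp (A t) (B t) = S at hS ⊢
  have hQQ : (1 - P) * (1 - P) = 1 - P := by
    rw [mul_sub, mul_one, sub_mul, one_mul, hPP, sub_self, sub_zero]
  have e1 : traceCLM V (star (P * S * P) * (P * S * P)) = traceCLM V (P * S * P * S) := by
    have : star (P * S * P) = P * S * P := by simp only [star_mul, hP, hS, mul_assoc]
    rw [this, mul_assoc (P * S), ← mul_assoc P (P * S) P, ← mul_assoc P P S, hPP,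
      ← mul_assoc, traceCLM_mul_comm, ← mul_assoc, ← mul_assoc, ← mul_assoc, hPP]
  have e2 : traceCLM V (star ((1 - P) * S * P) * ((1 - P) * S * P)) =
      traceCLM V (P * S * (1 - P) * S) := by
    have : star ((1 - P) * S * P) = P * S * (1 - P) := by
      simp only [star_mul, star_sub, star_one, hP, hS, mul_assoc]
    rw [this, mul_assoc (P * S), ← mul_assoc (1 - P) ((1 - P) * S) P, ← mul_assoc (1 - P) (1 - P) S,
      hQQ, ← mul_assoc, traceCLM_mul_comm, ← mul_assoc, ← mul_assoc, ← mul_assoc, hPP]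
  have e3 : traceCLM V ((1 - P) * S * P * S) = traceCLM V (P * S * (1 - P) * S) := by
    rw [mul_assoc ((1 - P) * S), traceCLM_mul_comm, ← mul_assoc]
  have e4 : traceCLM V (P * S * S) =
      traceCLM V (P * S * P * S) + traceCLM V (P * S * (1 - P) * S) := by
    rw [← map_add]; congr 1; noncomm_ring
  rw [e1, e2, traceCLM_mul_comm (R t) P]
  simp only [sub_mul (-(P * S * (1 - P))), neg_mul, mul_sub P (-R t), mul_neg, map_add, map_sub,
    map_neg, e3, ← mul_assoc, e4]
  ring

end IsLagrangianFrame

end LagrangianFrame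

section Rigidity

open Filter Topology Set
open scoped InnerProductSpace

namespace IsLagrangianFrame

variable [FiniteDimensional ℝ V] [CompleteSpace V] {R A B : ℝ → V →L[ℝ] V}
  (h : IsLagrangianFrame R A B)

include h

lemma eventually_isUnit_right (t : ℝ) : ∀ᶠ u in 𝓝[>] t, t < u ∧ IsUnit (A u) :=
  (eventually_mem_nhdsWithin (a := t) (s := Ioi t)).and
    ((h.eventually_isUnit t).filter_mono (nhdsWithin_mono t fun _ hu => ne_of_gt hu))

omit h in
lemma traceCLM_mul_horizontalProj_nonneg {k : ℕ} {X A B : V →L[ℝ] V}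
    (hX : ∀ e : Fin k → V, Orthonormal ℝ e → 0 ≤ ∑ i, ⟪X (e i), e i⟫_ℝ)
    {U : Submodule ℝ V} (hdim : Module.finrank ℝ U + k = Module.finrank ℝ V)
    (hA : IsUnit A) : 0 ≤ traceCLM V (X * horizontalProj U A B) := by
  rw [← regularized_eq hA B] at hA
  have hinj : Function.Injective (regularized A B : V →ₗ[ℝ] V) :=
    (ContinuousLinearMap.isUnit_iff_bijective.1 hA).1
  rw [horizontalProj, ← Submodule.starProjection_orthogonal']
  set K := U.map (regularized A B : V →ₗ[ℝ] V)
  have hK : Module.finrank ℝ K = Module.finrank ℝ U :=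
    (Submodule.equivMapOfInjective _ hinj U).finrank_eq.symm
  have hKo : Module.finrank ℝ Kᗮ = k := by
    have := K.finrank_add_finrank_orthogonal
    omega
  let b := (stdOrthonormalBasis ℝ Kᗮ).reindex (finCongr hKo)
  have hb : Orthonormal ℝ fun i => (b i : V) := b.orthonormal.comp_linearIsometry Kᗮ.subtypeₗᵢ
  rw [traceCLM_mul_starProjection X Kᗮ hb]
  · exact hX _ hb
  · have h1 := b.toBasis.span_eq
    have h2 := congrArg (Submodule.map Kᗮ.subtype) h1
    rw [Submodule.map_span, ← range_comp, Submodule.map_top, Submodule.range_subtype,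
      OrthonormalBasis.coe_toBasis] at h2
    exact h2

variable {U : Submodule ℝ V} {t₀ : ℝ} {k : ℕ} (hU : ∀ t, t₀ ≤ t → ∀ x, A t x = 0 → x ∈ U)
  (hdim : Module.finrank ℝ U + k = Module.finrank ℝ V)
  (hRic : ∀ t, ∀ e : Fin k → V, Orthonormal ℝ e → 0 ≤ ∑ i, ⟪R t (e i), e i⟫_ℝ)
  (htr : traceCLM V (riccatiOp U (A t₀) (B t₀)) ≤ 0)

include hU hdim hRic htr

lemma traceCLM_riccatiOp_eq_zero {t : ℝ} (ht : t₀ ≤ t) :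
    traceCLM V (riccatiOp U (A t) (B t)) = 0 := by
  have hn : (0 : ℝ) < Module.finrank ℝ V + 1 := by positivity
  refine eq_zero_of_riccati_inequality (f := fun u => traceCLM V (riccatiOp U (A u) (B u)))
    (inv_pos.2 hn) (fun t ht =>
      (traceCLM V).continuous.continuousAt.comp (h.continuousAt_riccatiOp (hU t ht)))
    (fun t ht => ?_) htr ht
  filter_upwards [h.eventually_isUnit_right t] with u hu
  refine ⟨_, ?_, h.hasDerivAt_trace_riccatiOp U hu.2⟩
  have h1 := traceCLM_mul_horizontalProj_nonneg (B := B u) (hRic u) hdim hu.2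
  have h2 := traceCLM_star_mul_self_nonneg ((1 - horizontalProj U (A u) (B u)) *
    shapeOp (A u) (B u) * horizontalProj U (A u) (B u))
  have h3 := sq_traceCLM_le (riccatiOp U (A u) (B u))
  have h4 := traceCLM_star_mul_self_nonneg (riccatiOp U (A u) (B u))
  have h5 : (Module.finrank ℝ V + 1 : ℝ)⁻¹ * traceCLM V (riccatiOp U (A u) (B u)) ^ 2 ≤
      traceCLM V (star (riccatiOp U (A u) (B u)) * riccatiOp U (A u) (B u)) := by
    rw [inv_mul_le_iff₀ hn]
    linarith
  linarith

lemma shapeOp_mul_horizontalProj_eq_zero {t : ℝ} (ht : t₀ < t) (hAt : IsUnit (A t)) :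
    shapeOp (A t) (B t) * horizontalProj U (A t) (B t) = 0 := by
  have hd : HasDerivAt (fun u => traceCLM V (riccatiOp U (A u) (B u))) 0 t := by
    refine (hasDerivAt_const t (0 : ℝ)).congr_of_eventuallyEq ?_
    filter_upwards [lt_mem_nhds ht] with u hu
    exact h.traceCLM_riccatiOp_eq_zero hU hdim hRic htr hu.le
  have h0 := hd.unique (h.hasDerivAt_trace_riccatiOp U hAt)
  have h1 := traceCLM_mul_horizontalProj_nonneg (B := B t) (hRic t) hdim hAt
  have h2 := traceCLM_star_mul_self_nonneg ((1 - horizontalProj U (A t) (B t)) *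
    shapeOp (A t) (B t) * horizontalProj U (A t) (B t))
  have h4 := traceCLM_star_mul_self_nonneg (riccatiOp U (A t) (B t))
  have h5 := eq_zero_of_traceCLM_star_mul_self (by linarith :
    traceCLM V (star (riccatiOp U (A t) (B t)) * riccatiOp U (A t) (B t)) = 0)
  have h6 := eq_zero_of_traceCLM_star_mul_self (by linarith :
    traceCLM V (star ((1 - horizontalProj U (A t) (B t)) *
      shapeOp (A t) (B t) * horizontalProj U (A t) (B t)) *
      ((1 - horizontalProj U (A t) (B t)) *
      shapeOp (A t) (B t) * horizontalProj U (A t) (B t))) = 0)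
  rw [sub_mul, sub_mul, one_mul, ← riccatiOp, h5, sub_zero] at h6
  exact h6

lemma horizontalProj_eq {t : ℝ} (ht : t₀ ≤ t) :
    horizontalProj U (A t) (B t) = horizontalProj U (A t₀) (B t₀) := by
  ext x
  refine ext_inner_left ℝ fun y => ?_
  refine eq_of_eventually_hasDerivAt_zero
    (f := fun u => ⟪y, horizontalProj U (A u) (B u) x⟫_ℝ) (fun t ht => ?_) (fun t ht => ?_) ht
  · exact continuousAt_const.inner ((h.continuousAt_horizontalProj (hU t ht)).clm_apply
      continuousAt_const)
  · filter_upwards [h.eventually_isUnit_right t] with u hu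
    have hSP := h.shapeOp_mul_horizontalProj_eq_zero hU hdim hRic htr (ht.trans_lt hu.1) hu.2
    have hPS := congrArg star hSP
    rw [star_mul, star_zero, star_horizontalProj, (h.isLagrangianPair u).star_shapeOp hu.2] at hPS
    have hd := h.hasDerivAt_horizontalProj U hu.2
    rw [hPS, mul_assoc, hSP, zero_mul, mul_zero, neg_zero, sub_zero] at hd
    have := (hasDerivAt_const u y).inner ℝ (hd.clm_apply (hasDerivAt_const u x))
    simpa using this

/-- Horizontal vectors at the initial time are, as constant fields, members of the family. -/
lemma exists_apply_eq_const (hR : Continuous R) {w : V}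
    (hw : horizontalProj U (A t₀) (B t₀) w = w) : ∃ v, ∀ t, t₀ ≤ t → A t v = w := by
  have hP : ∀ t, t₀ ≤ t → horizontalProj U (A t) (B t) w = w := fun t ht => by
    rw [h.horizontalProj_eq hU hdim hRic htr ht, hw]
  have hS : ∀ t, t₀ < t → IsUnit (A t) → shapeOp (A t) (B t) w = 0 := fun t ht hAt => by
    rw [← hP t ht.le, ← mul_apply_eq_comp,
      h.shapeOp_mul_horizontalProj_eq_zero hU hdim hRic htr ht hAt, zero_apply]
  have hRu : ∀ t, t₀ < t → IsUnit (A t) → R t w = 0 := fun t ht hAt => by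
    have hd := (h.hasDerivAt_shapeOp hAt).clm_apply (hasDerivAt_const t w)
    have hz : HasDerivAt (fun u => shapeOp (A u) (B u) w) 0 t := by
      refine (hasDerivAt_const t (0 : V)).congr_of_eventuallyEq ?_
      filter_upwards [lt_mem_nhds ht, h.eventually_isUnit_nhds hAt] with u hu hAu
      exact hS u hu hAu
    have := hz.unique hd
    simpa [hS t ht hAt] using this.symm
  have hR0 : ∀ t, t₀ ≤ t → R t w = 0 := fun t ht => by
    refine tendsto_nhds_unique_of_frequently_eq (f := fun u => R u w) (g := fun _ => (0 : V))
      (l := 𝓝[>] t) ?_ tendsto_const_nhds (Eventually.frequently ?_)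
    · exact ((hR.clm_apply continuous_const).tendsto t).mono_left nhdsWithin_le_nhds
    · filter_upwards [h.eventually_isUnit_right t] with u hu
      exact hRu u (ht.trans_lt hu.1) hu.2
  obtain ⟨t₁, ht₁, hA₁⟩ := (h.eventually_isUnit_right t₀).exists
  obtain ⟨v, hv⟩ := (ContinuousLinearMap.isUnit_iff_bijective.1 hA₁).2 w
  refine ⟨v, fun t ht => sub_eq_zero.1 ?_⟩
  have hAd : ∀ u, HasDerivAt (fun u => A u v - w) (B u v) u := fun u => by
    simpa using ((h.hasDerivAt_left u).clm_apply (hasDerivAt_const u v)).sub_const w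
  have hBd : ∀ u, HasDerivAt (fun u => B u v) (-(R u (A u v))) u := fun u => by
    simpa using (h.hasDerivAt_right u).clm_apply (hasDerivAt_const u v)
  have hB₁ : B t₁ v = 0 := by
    have := hS t₁ ht₁ hA₁
    rw [← hv, (h.isLagrangianPair t₁).shapeOp_apply] at this
    simpa [kerProj_eq_zero hA₁] using this
  refine eqOn_zero_of_linear_second_order hR (Y := fun u => A u v - w) (Z := fun u => B u v)
    (a := t₀) (b := max t t₁ + 1) (t := t₁) ⟨ht₁, (le_max_right t t₁).trans_lt (lt_add_one _)⟩
    (fun u _ => (hAd u).continuousAt.continuousWithinAt)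
    (fun u _ => (hBd u).continuousAt.continuousWithinAt) (fun u _ => hAd u) (fun u hu => ?_)
    (by simp [hv]) hB₁ ⟨ht, (le_max_left t t₁).trans (lt_add_one _).le⟩
  rw [map_sub, hR0 u hu.1.le, sub_zero]
  exact hBd u

end IsLagrangianFrame

end Rigidity

section JacobiField

open Filter Topology Set
open scoped InnerProductSpace

variable {R : ℝ → V →L[ℝ] V}

namespace IsJacobiField

variable {J : ℝ → V} (hJ : IsJacobiField R J)

include hJ

lemma hasDerivAt (t : ℝ) : HasDerivAt J (deriv J t) t :=
  ((hJ.1.differentiable (by simp)) t).hasDerivAt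

lemma hasDerivAt_deriv (t : ℝ) : HasDerivAt (deriv J) (-(R t (J t))) t := by
  rw [← hJ.2 t]
  have h : ContDiff ℝ (⊤ : ℕ∞) (deriv J) := (contDiff_infty_iff_deriv.1 hJ.1).2
  exact ((h.differentiable (by simp)) t).hasDerivAt

lemma eq_zero (hR : Continuous R) {t : ℝ} (h0 : J t = 0) (h1 : deriv J t = 0) : J = 0 := by
  funext u
  refine eqOn_zero_of_linear_second_order hR (Y := J) (Z := deriv J)
    (a := min t u - 1) (b := max t u + 1) (t := t)
    ⟨by linarith [min_le_left t u], by linarith [le_max_left t u]⟩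
    (fun u _ => (hJ.hasDerivAt u).continuousAt.continuousWithinAt)
    (fun u _ => (hJ.hasDerivAt_deriv u).continuousAt.continuousWithinAt)
    (fun u _ => hJ.hasDerivAt u) (fun u _ => hJ.hasDerivAt_deriv u) h0 h1
    ⟨by linarith [min_le_right t u], by linarith [le_max_right t u]⟩

lemma eq_zero_of_eqOn_Ici (hR : Continuous R) {a : ℝ} (h : ∀ t, a ≤ t → J t = 0) : J = 0 := by
  have ha : a < a + 1 := lt_add_one a
  have hd : HasDerivAt J 0 (a + 1) := (hasDerivAt_const (a + 1) (0 : V)).congr_of_eventuallyEq <| by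
    filter_upwards [lt_mem_nhds ha] with u hu using h u hu.le
  exact hJ.eq_zero hR (h _ ha.le) hd.deriv

end IsJacobiField

variable [FiniteDimensional ℝ V]

lemma hasDerivAt_toContinuousLinearMap {a : ℝ → V →ₗ[ℝ] V} {a' : V →ₗ[ℝ] V} {t : ℝ}
    (h : ∀ v, HasDerivAt (fun u => a u v) (a' v) t) :
    HasDerivAt (fun u => (a u).toContinuousLinearMap) a'.toContinuousLinearMap t := by
  let b := stdOrthonormalBasis ℝ V
  have hsum : ∀ L : V →ₗ[ℝ] V, L.toContinuousLinearMap =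
      ∑ i, ContinuousLinearMap.smulRightL ℝ V V (innerSL ℝ (b i)) (L (b i)) := by
    intro L
    ext v
    conv_lhs => rw [← b.sum_repr' v]
    simp
  simp only [hsum]
  exact HasDerivAt.fun_sum fun i _ =>
    (ContinuousLinearMap.smulRightL ℝ V V (innerSL ℝ (b i))).hasFDerivAt.comp_hasDerivAt t (h (b i))

namespace IsLagrangian

variable {Λ : Submodule ℝ (ℝ → V)} (hΛ : IsLagrangian R Λ)

include hΛ

lemma nonempty_linearEquiv : Nonempty (V ≃ₗ[ℝ] Λ) := by
  cases subsingleton_or_nontrivial V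
  · exact ⟨0⟩
  · have : FiniteDimensional ℝ Λ :=
      Module.finite_of_finrank_pos (hΛ.2.1 ▸ Module.finrank_pos (R := ℝ) (M := V))
    exact ⟨LinearEquiv.ofFinrankEq V Λ hΛ.2.1.symm⟩

lemma exists_isLagrangianFrame (hR : Continuous R) :
    ∃ (φ : V ≃ₗ[ℝ] Λ) (A B : ℝ → V →L[ℝ] V), IsLagrangianFrame R A B ∧
      (∀ t v, A t v = (φ v : ℝ → V) t) ∧ ∀ t v, B t v = deriv (φ v : ℝ → V) t := by
  obtain ⟨φ⟩ := hΛ.nonempty_linearEquiv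
  have hφ : ∀ v, IsJacobiField R (φ v) := fun v => hΛ.1 _ (φ v).2
  have hadd : ∀ v w t, deriv (φ (v + w) : ℝ → V) t =
      deriv (φ v : ℝ → V) t + deriv (φ w : ℝ → V) t := fun v w t => by
    rw [map_add, Submodule.coe_add]
    exact (((hφ v).hasDerivAt t).add ((hφ w).hasDerivAt t)).deriv
  have hsmul : ∀ (c : ℝ) v t, deriv (φ (c • v) : ℝ → V) t = c • deriv (φ v : ℝ → V) t :=
    fun c v t => by
      rw [map_smul, Submodule.coe_smul]
      exact (((hφ v).hasDerivAt t).const_smul c).deriv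
  let a : ℝ → V →ₗ[ℝ] V := fun t =>
    { toFun := fun v => (φ v : ℝ → V) t, map_add' := by simp, map_smul' := by simp }
  let a' : ℝ → V →ₗ[ℝ] V := fun t =>
    { toFun := fun v => deriv (φ v : ℝ → V) t
      map_add' := fun v w => hadd v w t
      map_smul' := fun c v => hsmul c v t }
  refine ⟨φ, fun t => (a t).toContinuousLinearMap, fun t => (a' t).toContinuousLinearMap,
    ⟨fun t => hasDerivAt_toContinuousLinearMap fun v => (hφ v).hasDerivAt t, fun t => ?_,
      fun t => ⟨fun x y => hΛ.2.2 _ (φ x).2 _ (φ y).2 t, fun x h0 h1 => ?_⟩⟩,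
    fun _ _ => rfl, fun _ _ => rfl⟩
  · exact hasDerivAt_toContinuousLinearMap
      (a' := ((-(R t * (a t).toContinuousLinearMap) : V →L[ℝ] V) : V →ₗ[ℝ] V))
      fun v => (hφ v).hasDerivAt_deriv t
  · exact φ.map_eq_zero_iff.1 (Subtype.ext ((hφ x).eq_zero hR h0 h1))

end IsLagrangian

end JacobiField

section OrthogonalEvaluation

open scoped InnerProductSpace

variable [FiniteDimensional ℝ V] {A B : V →L[ℝ] V} {U W : Submodule ℝ V}
  (hUW : ∀ u, u ∈ U ↔ ∀ w ∈ W, ⟪A u, w⟫_ℝ = 0) (hW : ∀ w ∈ W, ∃ v, A v = w)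

include hUW hW

lemma finrank_add_finrank_of_forall_inner_eq_zero :
    Module.finrank ℝ U + Module.finrank ℝ W = Module.finrank ℝ V := by
  let L : V →ₗ[ℝ] V := (W.starProjection * A : V →L[ℝ] V)
  have hker : LinearMap.ker L = U := by
    ext u
    rw [hUW, LinearMap.mem_ker]
    change W.starProjection (A u) = 0 ↔ _
    rw [Submodule.starProjection_apply_eq_zero_iff, Submodule.mem_orthogonal']
  have hrange : LinearMap.range L = W := by
    refine le_antisymm ?_ fun w hw => ?_
    · rintro _ ⟨v, rfl⟩
      exact Submodule.starProjection_apply_mem W (A v)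
    · obtain ⟨v, rfl⟩ := hW w hw
      exact ⟨v, Submodule.starProjection_eq_self_iff.2 hw⟩
  rw [← hker, ← hrange, add_comm]
  exact L.finrank_range_add_finrank_ker

lemma IsLagrangianPair.horizontalProj_eq_starProjection [CompleteSpace V]
    (h : IsLagrangianPair A B) : horizontalProj U A B = W.starProjection := by
  have hU : ∀ x, A x = 0 → x ∈ U := fun x hx => (hUW x).2 fun w _ => by rw [hx, inner_zero_left]
  have hP : horizontalProj U A B =
      (U.map (regularized A B : V →ₗ[ℝ] V))ᗮ.starProjection := by
    rw [horizontalProj, Submodule.starProjection_orthogonal']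
  have hfix : ∀ w, horizontalProj U A B w = w ↔ w ∈ (U.map (regularized A B : V →ₗ[ℝ] V))ᗮ := by
    intro w
    rw [hP, Submodule.starProjection_eq_self_iff]
  obtain rfl : W = (U.map (regularized A B : V →ₗ[ℝ] V))ᗮ := by
    refine le_antisymm (fun w hw => (hfix w).1 ?_) fun x hx => ?_
    · refine horizontalProj_eq_self (fun u hu => (hUW u).1 hu w hw) fun u hu => ?_
      obtain ⟨v, rfl⟩ := hW w hw
      rw [h.wronskian, hu, inner_zero_left]
    · have hPx := (hfix x).2 hx
      obtain ⟨v, hv⟩ := h.exists_apply_eq_horizontalProj hU x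
      obtain ⟨v', hv'⟩ := hW _ (Submodule.starProjection_apply_mem W x)
      have hd : x - W.starProjection x ∈ Wᗮ := Submodule.sub_starProjection_mem_orthogonal x
      have hvU : v - v' ∈ U := (hUW _).2 fun w hw => by
        rw [map_sub, hv, hPx, hv']
        exact Submodule.inner_left_of_mem_orthogonal hw hd
      have h0 := inner_apply_horizontalProj hU B hvU x
      rw [hPx, map_sub, hv, hPx, hv'] at h0
      have h1 := Submodule.inner_left_of_mem_orthogonal
        (Submodule.starProjection_apply_mem W x) hd
      have h2 : ⟪x - W.starProjection x, x - W.starProjection x⟫_ℝ = 0 := by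
        rw [inner_sub_right, h0, h1, sub_zero]
      rw [sub_eq_zero.1 (inner_self_eq_zero.1 h2)]
      exact Submodule.starProjection_apply_mem W x
  exact hP

end OrthogonalEvaluation

/-- **Splitting in nonnegative intermediate Ricci curvature (Lemma 10).** Under
the radial bound `Ric_k ≥ 0`, with initial trace condition `≤ 0` on a
`k`-dimensional `W ⊆ {J(t₀) : J ∈ Λ}`, and `𝒱 = {J ∈ Λ : J(t₀) ⊥ W}` of full
index on `[t₀, ∞)`, the Lagrangian `Λ` splits orthogonally on `[t₀, ∞)` as
`𝒱 ⊕ ℋ`, and every nonzero `K ∈ ℋ` has the form `K = f·E` there, with `E` a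
unit vector in `W` and `f'' = 0`, `f(t₀) = |K(t₀)|`. -/
theorem riccati_comparison_splitting_nonneg
    [FiniteDimensional ℝ V]
    (k : ℕ)
    (R : ℝ → V →L[ℝ] V)
    (hR_smooth : ContDiff ℝ (⊤ : ℕ∞) R)
    (hR_sym : ∀ t : ℝ, ∀ x y : V, ⟪R t x, y⟫ = ⟪x, R t y⟫)
    (hRic : ∀ t : ℝ, ∀ e : Fin k → V, Orthonormal ℝ e →
      0 ≤ ∑ i, ⟪R t (e i), e i⟫)
    (Λ : Submodule ℝ (ℝ → V)) (hΛ : IsLagrangian R Λ)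
    (t₀ : ℝ)
    (W : Submodule ℝ V) (hWdim : Module.finrank ℝ W = k)
    (hWsub : ∀ x ∈ W, ∃ J ∈ Λ, J t₀ = x)
    (e : Fin k → V) (heW : ∀ i, e i ∈ W) (heON : Orthonormal ℝ e)
    (hespan : Submodule.span ℝ (Set.range e) = W)
    (J : Fin k → (ℝ → V)) (hJΛ : ∀ i, J i ∈ Λ) (hJe : ∀ i, J i t₀ = e i)
    (hinit : ∑ i, ⟪deriv (J i) t₀, e i⟫ ≤ 0)
    (𝒱 : Submodule ℝ (ℝ → V))
    (h𝒱 : ∀ X : ℝ → V, X ∈ 𝒱 ↔ (X ∈ Λ ∧ ∀ w ∈ W, ⟪X t₀, w⟫ = 0))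
    (hfull : ∀ t ∈ Set.Ici t₀, ∀ X ∈ Λ, X t = 0 → X ∈ 𝒱) :
    ∃ ℋ : Submodule ℝ (ℝ → V), ℋ ≤ Λ ∧ 𝒱 ⊔ ℋ = Λ ∧ 𝒱 ⊓ ℋ = ⊥ ∧
      (∀ t ∈ Set.Ici t₀, ∀ X ∈ 𝒱, ∀ Y ∈ ℋ, ⟪X t, Y t⟫ = 0) ∧
      ∀ Y ∈ ℋ, Y ≠ 0 →
        ∃ (E : V) (f : ℝ → ℝ),
          ‖E‖ = 1 ∧ E ∈ W ∧
          f t₀ = ‖Y t₀‖ ∧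
          (∀ t ∈ Set.Ici t₀, HasDerivAt f (deriv f t) t) ∧
          (∀ t ∈ Set.Ici t₀, HasDerivAt (deriv f) 0 t) ∧
          ∀ t ∈ Set.Ici t₀, Y t = f t • E := by
  have := FiniteDimensional.complete ℝ V
  have hR : Continuous R := hR_smooth.continuous
  obtain ⟨φ, A, B, h, hA, hB⟩ := hΛ.exists_isLagrangianFrame hR
  have hφ : ∀ X ∈ Λ, ∃ v, (φ v : ℝ → V) = X := fun X hX =>
    ⟨φ.symm ⟨X, hX⟩, by rw [φ.apply_symm_apply]⟩
  let U : Submodule ℝ V := 𝒱.comap (Λ.subtype ∘ₗ (φ : V →ₗ[ℝ] Λ))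
  have hUW : ∀ u, u ∈ U ↔ ∀ w ∈ W, ⟪A t₀ u, w⟫ = 0 := fun u => by
    change (φ u : ℝ → V) ∈ 𝒱 ↔ _
    simp only [h𝒱, hA, (φ u).2, true_and]
  have hWA : ∀ w ∈ W, ∃ v, A t₀ v = w := fun w hw => by
    obtain ⟨X, hX, rfl⟩ := hWsub w hw
    obtain ⟨v, rfl⟩ := hφ X hX
    exact ⟨v, hA t₀ v⟩
  have hU : ∀ t, t₀ ≤ t → ∀ x, A t x = 0 → x ∈ U := fun t ht x hx =>
    hfull t ht (φ x) (φ x).2 (by rw [← hA, hx])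
  have hdim : Module.finrank ℝ U + k = Module.finrank ℝ V := by
    rw [← hWdim]
    exact finrank_add_finrank_of_forall_inner_eq_zero hUW hWA
  have hP₀ := (h.isLagrangianPair t₀).horizontalProj_eq_starProjection hUW hWA
  have hPW : ∀ w ∈ W, horizontalProj U (A t₀) (B t₀) w = w := fun w hw => by
    rw [hP₀, Submodule.starProjection_eq_self_iff.2 hw]
  have htr : traceCLM V (riccatiOp U (A t₀) (B t₀)) ≤ 0 := by
    have hmul : riccatiOp U (A t₀) (B t₀) = riccatiOp U (A t₀) (B t₀) * W.starProjection := by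
      rw [← hP₀, riccatiOp, mul_assoc (_ * _), horizontalProj_mul_self]
    rw [hmul, traceCLM_mul_starProjection _ W heON hespan]
    refine le_of_eq_of_le (Finset.sum_congr rfl fun i _ => ?_) hinit
    obtain ⟨v, hv⟩ := hφ (J i) (hJΛ i)
    have hAv : A t₀ v = horizontalProj U (A t₀) (B t₀) (e i) := by
      rw [hPW _ (heW i), hA, hv, hJe]
    rw [(h.isLagrangianPair t₀).riccatiOp_apply (hU t₀ le_rfl) hAv, hB, hv, hP₀,
      Submodule.inner_starProjection_left_eq_right,
      Submodule.starProjection_eq_self_iff.2 (heW i)]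
  let ℋ : Submodule ℝ (ℝ → V) :=
    { carrier := {Y | Y ∈ Λ ∧ ∃ w ∈ W, ∀ t, t₀ ≤ t → Y t = w}
      add_mem' := by
        rintro Y Z ⟨hY, w, hw, hYw⟩ ⟨hZ, z, hz, hZz⟩
        exact ⟨Λ.add_mem hY hZ, w + z, W.add_mem hw hz, fun t ht => by simp [hYw t ht, hZz t ht]⟩
      zero_mem' := ⟨Λ.zero_mem, 0, W.zero_mem, fun _ _ => rfl⟩
      smul_mem' := by
        rintro c Y ⟨hY, w, hw, hYw⟩
        exact ⟨Λ.smul_mem c hY, c • w, W.smul_mem c hw, fun t ht => by simp [hYw t ht]⟩ }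
  have hℋΛ : ℋ ≤ Λ := fun Y hY => hY.1
  have h𝒱Λ : 𝒱 ≤ Λ := fun X hX => ((h𝒱 X).1 hX).1
  refine ⟨ℋ, hℋΛ, le_antisymm (sup_le h𝒱Λ hℋΛ) fun X hX => ?_, ?_, ?_, ?_⟩
  · have hw := Submodule.starProjection_apply_mem W (X t₀)
    obtain ⟨v, hv⟩ := h.exists_apply_eq_const hU hdim hRic htr hR (hPW _ hw)
    refine Submodule.mem_sup.2 ⟨X - φ v, (h𝒱 _).2 ⟨Λ.sub_mem hX (φ v).2, fun w hw => ?_⟩, φ v,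
      ⟨(φ v).2, _, hw, fun t ht => by rw [← hA, hv t ht]⟩, sub_add_cancel _ _⟩
    rw [Pi.sub_apply, ← hA, hv t₀ le_rfl]
    exact Submodule.inner_left_of_mem_orthogonal hw (Submodule.sub_starProjection_mem_orthogonal _)
  · refine (Submodule.eq_bot_iff _).2 fun X hX => ?_
    obtain ⟨hX𝒱, hXΛ, w, hw, hXw⟩ := hX
    have hw0 : w = 0 := by
      have := ((h𝒱 X).1 hX𝒱).2 w hw
      rw [hXw t₀ le_rfl] at this
      exact inner_self_eq_zero.1 this
    exact (hΛ.1 X hXΛ).eq_zero_of_eqOn_Ici hR fun t ht => by rw [hXw t ht, hw0]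
  · rintro t ht X hX Y ⟨-, w, hw, hYw⟩
    obtain ⟨u, rfl⟩ := hφ X (h𝒱Λ hX)
    have h0 := inner_apply_horizontalProj (hU t ht) (B t) (u := u) hX w
    rwa [h.horizontalProj_eq hU hdim hRic htr ht, hPW w hw, hA, ← hYw t ht] at h0
  · rintro Y ⟨hYΛ, w, hw, hYw⟩ hY0
    have hw0 : w ≠ 0 := fun hw0 => hY0 <|
      (hΛ.1 Y hYΛ).eq_zero_of_eqOn_Ici hR fun t ht => by rw [hYw t ht, hw0]
    refine ⟨‖w‖⁻¹ • w, fun _ => ‖w‖, norm_smul_inv_norm hw0, W.smul_mem _ hw, by rw [hYw t₀ le_rfl],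
      fun t _ => ?_, fun t _ => ?_, fun t ht => ?_⟩
    · rw [deriv_const]
      exact hasDerivAt_const t _
    · rw [deriv_const']
      exact hasDerivAt_const t _
    · rw [hYw t ht, smul_inv_smul₀ (norm_ne_zero_iff.2 hw0)]
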